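/- arXiv:1901.02028 — 2 statements merged into one kernel-verified Lean document; each statement's English description precedes it below -/
import Mathlib

section
/- Addendum Lemma 3.5 (= Proposition 14.5, pointwise form): Let V be a finite-dimensional real vector space, and let ρ, κ, ζ be complex-valued 1-forms on V such that ρ̄ = ρ and the five 1-forms ρ, κ, ζ, κ̄, ζ̄ are linearly independent over ℂ. Let Ω₁, Ω₂ be complex-valued 2-forms on V satisfying the three equations: (Ω₁ + Ω̄₁) ∧ ρ = 0, Ω₂ ∧ ρ + Ω₁ ∧ κ = 0, and (Ω₁ − Ω̄₁) ∧ ζ + i·Ω₂ ∧ κ = 0. Then there exist a real complex-valued 1-form Λ on V (i.e. Λ̄ = Λ) and a purely imaginary scalar h ∈ ℂ (i.e. h̄ = −h) such that Ω₁ = Λ ∧ ρ and Ω₂ = Λ ∧ κ + h·ρ ∧ κ. -/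
open Complex

/-- Complex-valued `p`-forms on a real vector space `V`: alternating
`ℝ`-multilinear maps `V^p → ℂ`. -/
abbrev CForm (V : Type*) [AddCommGroup V] [Module ℝ V] (p : ℕ) :=
  V [⋀^Fin p]→ₗ[ℝ] ℂ

/-- Wedge product of complex-valued alternating forms. -/
noncomputable def cwedge {V : Type*} [AddCommGroup V] [Module ℝ V] {p q : ℕ}
    (ω : CForm V p) (η : CForm V q) : CForm V (p + q) :=
  ((LinearMap.mul' ℝ ℂ).compAlternatingMap (ω.domCoprod η)).domDomCongr finSumFinEquiv

/-- Conjugate of a complex-valued form, obtained by postcomposing with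
complex conjugation. -/
def cconj {V : Type*} [AddCommGroup V] [Module ℝ V] {p : ℕ}
    (ω : CForm V p) : CForm V p :=
  Complex.conjAe.toLinearMap.compAlternatingMap ω

/-- The wedge product as a signed sum over all permutations, without denominators. -/
lemma factorial_smul_cwedge_apply {V : Type*} [AddCommGroup V] [Module ℝ V] {p q : ℕ}
    (ω : CForm V p) (η : CForm V q) (v : Fin (p + q) → V) :
    (p.factorial * q.factorial) • cwedge ω η v =
      ∑ σ : Equiv.Perm (Fin (p + q)), Equiv.Perm.sign σ •
        (ω (fun i => v (σ (Fin.castAdd q i))) * η (fun j => v (σ (Fin.natAdd p j)))) := by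
  have h := congrArg (fun f => LinearMap.mul' ℝ ℂ (f (v ∘ finSumFinEquiv)))
    (MultilinearMap.domCoprod_alternization_eq ω η)
  simp only [MultilinearMap.alternatization_apply, Fintype.card_fin, map_sum,
    AlternatingMap.smul_apply, map_nsmul] at h
  refine (Eq.trans ?_ h.symm).trans ?_
  · rfl
  · refine Fintype.sum_equiv finSumFinEquiv.permCongr _ _ fun σ => ?_
    rcases Int.units_eq_one_or (Equiv.Perm.sign σ) with hσ | hσ <;>
      simp [hσ, Equiv.permCongr_apply]

lemma CForm.apply_swap {V : Type*} [AddCommGroup V] [Module ℝ V] (ω : CForm V 2) (x y : V) :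
    ω ![x, y] = -ω ![y, x] := by
  rw [← ω.map_swap ![y, x] (show (0 : Fin 2) ≠ 1 by decide)]
  congr 1
  ext i
  fin_cases i <;> rfl

lemma cwedge_one_one_apply {V : Type*} [AddCommGroup V] [Module ℝ V]
    (ω η : CForm V 1) (x y : V) :
    cwedge ω η ![x, y] = ω ![x] * η ![y] - ω ![y] * η ![x] := by
  have h := factorial_smul_cwedge_apply ω η ![x, y]
  have hu : (Finset.univ : Finset (Equiv.Perm (Fin (1 + 1)))) = {1, Equiv.swap 0 1} := by decide
  have hf (θ : CForm V 1) (f : Fin 1 → V) : θ f = θ ![f 0] := by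
    congr 1; ext i; fin_cases i; rfl
  have hω (σ : Equiv.Perm (Fin (1 + 1))) : ω (fun i => ![x, y] (σ (Fin.castAdd 1 i))) =
      ω ![![x, y] (σ 0)] := hf _ _
  have hη (σ : Equiv.Perm (Fin (1 + 1))) : η (fun i => ![x, y] (σ (Fin.natAdd 1 i))) =
      η ![![x, y] (σ 1)] := hf _ _
  simp only [hω, hη] at h
  rw [hu, Finset.sum_pair (by decide)] at h
  simp at h
  rw [h]
  ring

lemma cwedge_two_one_apply {V : Type*} [AddCommGroup V] [Module ℝ V]
    (ω : CForm V 2) (η : CForm V 1) (x y z : V) :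
    cwedge ω η ![x, y, z] =
      ω ![x, y] * η ![z] - ω ![x, z] * η ![y] + ω ![y, z] * η ![x] := by
  have h := factorial_smul_cwedge_apply ω η ![x, y, z]
  have hu : (Finset.univ : Finset (Equiv.Perm (Fin (2 + 1)))) =
    {1, Equiv.swap 0 1, Equiv.swap 1 2, Equiv.swap 0 2, Equiv.swap 0 1 * Equiv.swap 1 2,
      Equiv.swap 1 2 * Equiv.swap 0 1} := by decide
  have hω (σ : Equiv.Perm (Fin (2 + 1))) : ω (fun i => ![x, y, z] (σ (Fin.castAdd 1 i))) =
      ω ![![x, y, z] (σ 0), ![x, y, z] (σ 1)] := by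
    congr 1; ext i; fin_cases i <;> rfl
  have hη (σ : Equiv.Perm (Fin (2 + 1))) : η (fun i => ![x, y, z] (σ (Fin.natAdd 2 i))) =
      η ![![x, y, z] (σ 2)] := by
    congr 1; ext i; fin_cases i; rfl
  simp only [hω, hη] at h
  rw [hu, Finset.sum_insert (by decide), Finset.sum_insert (by decide),
    Finset.sum_insert (by decide), Finset.sum_insert (by decide), Finset.sum_insert (by decide),
    Finset.sum_singleton] at h
  have t01 : (Equiv.swap (0 : Fin 3) 1) 2 = 2 := by decide
  have t12 : (Equiv.swap (1 : Fin 3) 2) 0 = 0 := by decide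
  have t02 : (Equiv.swap (0 : Fin 3) 2) 1 = 1 := by decide
  simp [t01, t12, t02] at h
  rw [ω.apply_swap y x, ω.apply_swap z x, ω.apply_swap z y] at h
  linear_combination (1 / 2) * h

/-- The coframe equations, evaluated on vectors: here `A` and `S` are the real and imaginary parts
of the first 2-form, `W` is the second one, and the vectors `eᵢ` are dual to the coframe. -/
lemma forms_eq_of_coframe_equations {V : Type*} (A S : V → V → ℝ) (W : V → V → ℂ)
    (r : V → ℝ) (k z : V → ℂ)
    (hS : ∀ x y, S x y = -S y x) (hW : ∀ x y, W x y = -W y x)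
    (h1 : ∀ x y w, A x y * r w - A x w * r y + A y w * r x = 0)
    (h2 : ∀ x y w, W x y * r w - W x w * r y + W y w * r x + ((A x y + S x y * I) * k w
      - (A x w + S x w * I) * k y + (A y w + S y w * I) * k x) = 0)
    (h3 : ∀ x y w, 2 * (S x y * z w - S x w * z y + S y w * z x) +
      (W x y * k w - W x w * k y + W y w * k x) = 0)
    (e₀ e₁ e₂ e₃ e₄ : V)
    (r0 : r e₀ = 1) (r1 : r e₁ = 0) (r2 : r e₂ = 0) (r3 : r e₃ = 0)
    (k0 : k e₀ = 0) (k1 : k e₁ = 1) (k2 : k e₂ = I) (k3 : k e₃ = 0) (k4 : k e₄ = 0)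
    (z0 : z e₀ = 0) (z1 : z e₁ = 0) (z2 : z e₂ = 0) (z3 : z e₃ = 1) (z4 : z e₄ = I) :
    ∀ x y, A x y = A x e₀ * r y - A y e₀ * r x ∧ S x y = 0 ∧
      W x y = A x e₀ * k y - A y e₀ * k x - W e₁ e₀ * (r x * k y - r y * k x) := by
  have S0 : S e₀ e₀ = 0 := by linarith [hS e₀ e₀]
  have W0 : W e₀ e₀ = 0 := by linear_combination (1 / 2) * hW e₀ e₀
  have hA' x y : A x y = A x e₀ * r y - A y e₀ * r x := by
    linear_combination h1 x y e₀ - A x y * r0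
  have hAc x y : (A x y : ℂ) = A x e₀ * r y - A y e₀ * r x := by exact_mod_cast hA' x y
  have hW' x y : W x y = W x e₀ * r y - W y e₀ * r x + (A x e₀ + S x e₀ * I) * k y
      - (A y e₀ + S y e₀ * I) * k x := by
    have := h2 x y e₀
    rw [r0, k0] at this
    push_cast at this
    linear_combination this
  obtain ⟨T, hT⟩ : ∃ T : V → V → ℝ, ∀ x y, T x y = S x y - S x e₀ * r y + S y e₀ * r x :=
    ⟨_, fun _ _ => rfl⟩
  have hTk x y w : T x y * k w - T x w * k y + T y w * k x = 0 := by
    have := h2 x y w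
    rw [hW' x y, hW' x w, hW' y w, hAc x y, hAc x w, hAc y w] at this
    apply mul_left_cancel₀ I_ne_zero
    simp only [hT]
    push_cast
    linear_combination this
  have hTre x y w : T x y * (k w).re - T x w * (k y).re + T y w * (k x).re = 0 := by
    simpa using congrArg re (hTk x y w)
  have hTim x y w : T x y * (k w).im - T x w * (k y).im + T y w * (k x).im = 0 := by
    simpa using congrArg im (hTk x y w)
  have hT1 x : T x e₁ = -T e₁ e₂ * (k x).im := by
    have := hTim x e₁ e₂
    simp only [k1, k2, one_im, I_im] at this
    linarith
  have hS' x y : S x y = S x e₀ * r y - S y e₀ * r x +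
      T e₁ e₂ * ((k x).re * (k y).im - (k x).im * (k y).re) := by
    have := hTre x y e₁
    rw [k1, one_re, hT1 x, hT1 y, hT] at this
    linear_combination this
  have hs : T e₁ e₂ = 0 := by
    have h12 : S e₁ e₂ = T e₁ e₂ := by rw [hT, r1, r2]; ring
    have := h3 e₁ e₂ e₃
    rw [hW' e₁ e₂, hW' e₁ e₃, hW' e₂ e₃, h12, r1, r2, r3, k1, k2, k3, z1, z2, z3] at this
    push_cast at this
    exact_mod_cast (show (T e₁ e₂ : ℂ) = 0 by linear_combination (1 / 2) * this)
  have hC x y : 2 * (S x e₀ * z y - S y e₀ * z x) + W x e₀ * k y - W y e₀ * k x = 0 := by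
    have := h3 x y e₀
    rw [k0, z0] at this
    linear_combination -this
  have hσ : S e₄ e₀ = 0 ∧ S e₃ e₀ = 0 := by
    have := hC e₄ e₃
    rw [k3, k4, z3, z4] at this
    have hre := congrArg re this
    have him := congrArg im this
    simp at hre him
    exact ⟨hre, him⟩
  have hσγ x : 2 * (S x e₀ : ℂ) = W e₃ e₀ * k x := by
    have := hC x e₃
    rw [k3, z3, hσ.2] at this
    push_cast at this
    linear_combination this
  have hγ3 : W e₃ e₀ = 0 := by
    have ha := congrArg im (hσγ e₁)
    have hb := congrArg im (hσγ e₂)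
    rw [k1] at ha
    rw [k2] at hb
    simp at ha hb
    exact Complex.ext hb.symm ha.symm
  have hσ0 x : S x e₀ = 0 := by
    have := hσγ x
    rw [hγ3] at this
    simpa using this
  have hγ x : W x e₀ = W e₁ e₀ * k x := by
    have := hC x e₁
    rw [hσ0, hσ0, k1] at this
    push_cast at this
    linear_combination this
  intro x y
  refine ⟨hA' x y, ?_, ?_⟩
  · rw [hS', hσ0, hσ0, hs]; ring
  · rw [hW', hσ0, hσ0, hγ x, hγ y]
    push_cast
    ring

/-- Independence of the coframe and its conjugate lets one prescribe its values on a vector. -/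
lemma exists_eval_eq {V : Type*} [AddCommGroup V] [Module ℝ V]
    (ρ κ ζ : CForm V 1) (hρ : cconj ρ = ρ)
    (hindep : LinearIndependent ℂ ![ρ, κ, ζ, cconj κ, cconj ζ]) (a : ℝ) (b c : ℂ) :
    ∃ v : V, ρ ![v] = a ∧ κ ![v] = b ∧ ζ ![v] = c := by
  let lin (θ : CForm V 1) : V →ₗ[ℝ] ℂ := (AlternatingMap.ofSubsingleton ℝ V ℂ 0).symm θ
  have hlin (θ : CForm V 1) (v : V) : lin θ v = θ ![v] := by
    change θ _ = θ _
    congr 1; ext i; fin_cases i; rfl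
  have hre (v : V) : ((ρ ![v]).re : ℂ) = ρ ![v] := by
    rw [← conj_eq_iff_re]
    exact congrArg (fun θ : CForm V 1 => θ ![v]) hρ
  let T : V →ₗ[ℝ] ℝ × ℂ × ℂ := (reLm ∘ₗ lin ρ).prod ((lin κ).prod (lin ζ))
  have hTx (v : V) : T v = ((ρ ![v]).re, κ ![v], ζ ![v]) := by
    rw [← hlin, ← hlin, ← hlin]
    rfl
  have hT : LinearMap.range T = ⊤ := by
    by_contra hne
    obtain ⟨f, hf0, hf⟩ := Submodule.exists_le_ker_of_lt_top _ (lt_top_iff_ne_top.2 hne)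
    have hfx (p : ℝ × ℂ × ℂ) : f p = p.1 * f (1, 0, 0) + p.2.1.re * f (0, 1, 0) +
        p.2.1.im * f (0, I, 0) + p.2.2.re * f (0, 0, 1) + p.2.2.im * f (0, 0, I) := by
      simp only [← smul_eq_mul, ← map_smul, ← map_add]
      congr 1
      refine Prod.ext ?_ (Prod.ext (Complex.ext ?_ ?_) (Complex.ext ?_ ?_)) <;> simp
    have hsum := Fintype.linearIndependent_iff.1 hindep
      ![(f (1, 0, 0) : ℂ), (f (0, 1, 0) - f (0, I, 0) * I) / 2,
        (f (0, 0, 1) - f (0, 0, I) * I) / 2, (f (0, 1, 0) + f (0, I, 0) * I) / 2,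
        (f (0, 0, 1) + f (0, 0, I) * I) / 2] (by
      ext v
      obtain ⟨x, rfl⟩ : ∃ x, v = ![x] := ⟨v 0, by ext i; fin_cases i; rfl⟩
      have h : f (T x) = 0 := hf ⟨x, rfl⟩
      rw [hfx] at h
      simp only [hTx] at h
      simp only [Fin.sum_univ_five, Matrix.cons_val, AlternatingMap.add_apply,
        AlternatingMap.smul_apply, AlternatingMap.zero_apply, smul_eq_mul]
      rw [← hre x]
      simp only [cconj, LinearMap.compAlternatingMap_apply]
      apply Complex.ext
      · simp
        linear_combination h
      · simp
        ring)
    have g0 := hsum 0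
    have g1 := hsum 1
    have g2 := hsum 2
    simp [Complex.ext_iff] at g0 g1 g2
    exact hf0 (LinearMap.ext fun p => by
      rw [hfx, g0, g1.1, g1.2, g2.1, g2.2]; simp)
  obtain ⟨v, hv⟩ := LinearMap.range_eq_top.1 hT (a, b, c)
  simp only [hTx, Prod.mk.injEq] at hv
  exact ⟨v, by rw [← hre, hv.1], hv.2⟩

/-- Addendum Lemma 3.5 (= Proposition 14.5, pointwise form): solutions of the
three homogeneous equations are of the form Ω₁ = Λ ∧ ρ, Ω₂ = Λ ∧ κ + h ρ ∧ κ
with Λ a real 1-form and h a purely imaginary scalar. -/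
theorem stmt_7 {V : Type*} [AddCommGroup V] [Module ℝ V] [FiniteDimensional ℝ V]
    (ρ κ ζ : CForm V 1) (hρ : cconj ρ = ρ)
    (hindep : LinearIndependent ℂ ![ρ, κ, ζ, cconj κ, cconj ζ])
    (Ω₁ Ω₂ : CForm V 2)
    (h1 : cwedge (Ω₁ + cconj Ω₁) ρ = 0)
    (h2 : cwedge Ω₂ ρ + cwedge Ω₁ κ = 0)
    (h3 : cwedge (Ω₁ - cconj Ω₁) ζ + Complex.I • cwedge Ω₂ κ = 0) :
    ∃ (Λ : CForm V 1) (h : ℂ), cconj Λ = Λ ∧ (starRingEnd ℂ) h = -h ∧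
      Ω₁ = cwedge Λ ρ ∧ Ω₂ = cwedge Λ κ + h • cwedge ρ κ := by
  obtain ⟨e₀, r0, k0, z0⟩ := exists_eval_eq ρ κ ζ hρ hindep 1 0 0
  obtain ⟨e₁, r1, k1, z1⟩ := exists_eval_eq ρ κ ζ hρ hindep 0 1 0
  obtain ⟨e₂, r2, k2, z2⟩ := exists_eval_eq ρ κ ζ hρ hindep 0 I 0
  obtain ⟨e₃, r3, k3, z3⟩ := exists_eval_eq ρ κ ζ hρ hindep 0 0 1
  obtain ⟨e₄, r4, k4, z4⟩ := exists_eval_eq ρ κ ζ hρ hindep 0 0 I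
  have hconj {p : ℕ} (θ : CForm V p) (v : Fin p → V) :
      cconj θ v = (starRingEnd ℂ) (θ v) := rfl
  have hre (v : V) : ((ρ ![v]).re : ℂ) = ρ ![v] := by
    rw [← conj_eq_iff_re, ← hconj, hρ]
  have hkey := forms_eq_of_coframe_equations (fun x y => (Ω₁ ![x, y]).re)
    (fun x y => (Ω₁ ![x, y]).im)
    (fun x y => Ω₂ ![x, y]) (fun x => (ρ ![x]).re) (fun x => κ ![x]) (fun x => ζ ![x])
    (fun x y => by rw [Ω₁.apply_swap]; simp) (fun x y => Ω₂.apply_swap x y)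
    (fun x y w => by
      have := congrArg (fun θ : CForm V 3 => (θ ![x, y, w]).re) h1
      rw [cwedge_two_one_apply] at this
      simp only [AlternatingMap.add_apply, hconj, add_conj] at this
      simp at this
      linear_combination (1 / 2) * this)
    (fun x y w => by
      have := congrArg (fun θ : CForm V 3 => θ ![x, y, w]) h2
      simp only [AlternatingMap.add_apply] at this
      rw [cwedge_two_one_apply, cwedge_two_one_apply] at this
      simpa only [re_add_im, hre, AlternatingMap.zero_apply] using this)
    (fun x y w => by
      have := congrArg (fun θ : CForm V 3 => θ ![x, y, w]) h3
      simp only [AlternatingMap.add_apply, AlternatingMap.smul_apply] at this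
      rw [cwedge_two_one_apply, cwedge_two_one_apply] at this
      simp only [AlternatingMap.sub_apply, hconj, sub_conj, smul_eq_mul,
        AlternatingMap.zero_apply] at this
      push_cast at this
      apply mul_left_cancel₀ I_ne_zero
      linear_combination this)
    e₀ e₁ e₂ e₃ e₄ (by simp [r0]) (by simp [r1]) (by simp [r2]) (by simp [r3])
    k0 k1 k2 k3 k4 z0 z1 z2 z3 z4
  have hmain (x y : V) : Ω₁ ![x, y] = (Ω₁ ![x, e₀]).re * ρ ![y] - (Ω₁ ![y, e₀]).re * ρ ![x] := by
    obtain ⟨ha, hs, -⟩ := hkey x y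
    rw [← re_add_im (Ω₁ ![x, y]), hs, ha]
    push_cast
    rw [hre, hre]
    ring
  obtain ⟨c, hc⟩ : ∃ c, c = Ω₂ ![e₁, e₀] := ⟨_, rfl⟩
  have hΛ (x : V) : (-(1 / 2 : ℂ) • (Ω₁.curryLeft e₀ + cconj (Ω₁.curryLeft e₀)) -
      (c.re : ℂ) • ρ) ![x] = (Ω₁ ![x, e₀]).re - c.re * ρ ![x] := by
    rw [Ω₁.apply_swap x e₀]
    simp only [AlternatingMap.sub_apply, AlternatingMap.smul_apply, AlternatingMap.add_apply,
      hconj, add_conj, AlternatingMap.curryLeft_apply_apply, smul_eq_mul, neg_re]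
    push_cast
    ring
  have hext2 {θ η : CForm V 2} (h : ∀ x y, θ ![x, y] = η ![x, y]) : θ = η := by
    ext v
    have hv : v = ![v 0, v 1] := by ext i; fin_cases i <;> rfl
    rw [hv, h]
  refine ⟨-(1 / 2 : ℂ) • (Ω₁.curryLeft e₀ + cconj (Ω₁.curryLeft e₀)) - (c.re : ℂ) • ρ,
    -(c.im * I), ?_, by simp, hext2 fun x y => ?_, hext2 fun x y => ?_⟩
  · ext v
    have hv : v = ![v 0] := by ext i; fin_cases i; rfl
    rw [hv, hconj, hΛ, ← hre]
    simp
  · rw [cwedge_one_one_apply, hΛ, hΛ, hmain]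
    ring
  · simp only [AlternatingMap.add_apply, AlternatingMap.smul_apply]
    rw [cwedge_one_one_apply, cwedge_one_one_apply, hΛ, hΛ, (hkey x y).2.2, ← hc, smul_eq_mul,
      hre, hre]
    linear_combination (ρ ![x] * κ ![y] - ρ ![y] * κ ![x]) * re_add_im c
end

section
/- Key identity for the boxed term in the computation of the secondary invariant R (Section 12): Let F be a commutative ℂ-algebra with a conjugation σ (a ring automorphism with σ∘σ = id and σ(z·f) = z̄·σ(f) for z ∈ ℂ, f ∈ F), and let L and L̄ be ℂ-linear derivations of F with σ(L̄(f)) = L(σ(f)) for all f ∈ F. Let K², K⁶, Z², Z⁵, Z⁸, W ∈ F satisfy W = Z⁵ − σ(Z⁸) − i·K² and the identity L̄(Z⁵) + L(Z⁸) = Z⁵·K⁶ + Z⁸·σ(K⁶) + i·Z². Then L̄(K²) + σ(L̄(K²)) = (i·L̄(W) − i·K⁶·W + K²·K⁶ + Z²) + σ(i·L̄(W) − i·K⁶·W + K²·K⁶ + Z²). -/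
/-- Key identity for the boxed term in the computation of the secondary
invariant `R` (Section 12): in a commutative ℂ-algebra `F` with conjugation
`σ` and conjugation-intertwined derivations `L`, `L̄`, given
`W = Z⁵ - σ Z⁸ - i K²` and identity (12.5), the real part of `L̄ K²` equals
the real part of `i L̄ W - i K⁶ W + K² K⁶ + Z²`. -/
theorem stmt_11 {F : Type*} [CommRing F] [Algebra ℂ F]
    (σ : F ≃+* F)
    (hσσ : ∀ f : F, σ (σ f) = f)
    (hσsmul : ∀ (z : ℂ) (f : F), σ (z • f) = (starRingEnd ℂ z) • σ f)
    (L Lbar : Derivation ℂ F F)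
    (hconj : ∀ f : F, σ (Lbar f) = L (σ f))
    (K2 K6 Z2 Z5 Z8 W : F)
    (hW : W = Z5 - σ Z8 - Complex.I • K2)
    (hid : Lbar Z5 + L Z8 = Z5 * K6 + Z8 * σ K6 + Complex.I • Z2) :
    Lbar K2 + σ (Lbar K2)
      = (Complex.I • Lbar W - Complex.I • (K6 * W) + K2 * K6 + Z2)
        + σ (Complex.I • Lbar W - Complex.I • (K6 * W) + K2 * K6 + Z2) := by
  have hL : Lbar (σ Z8) = σ (L Z8) := by
    rw [← hσσ (Lbar (σ Z8)), hconj, hσσ]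
  have hσid := congrArg σ hid
  have hjj : algebraMap ℂ F Complex.I * algebraMap ℂ F Complex.I = -1 := by
    rw [← map_mul, Complex.I_mul_I, map_neg, map_one]
  subst hW
  simp only [map_add, map_sub, map_mul, hσsmul, hσσ, hL, Complex.conj_I, Derivation.map_smul]
    at hid hσid ⊢
  simp only [Algebra.smul_def, map_neg] at hid hσid ⊢
  generalize algebraMap ℂ F Complex.I = j at *
  linear_combination (-j) * hid + j * hσid
    + (Lbar K2 - K6 * K2 + σ (Lbar K2) - σ K6 * σ K2 - Z2 - σ Z2) * hjj
end
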